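/- Let f : [a,b] → X be strongly Henstock–Kurzweil integrable on [a,b] and assume that for every t₁ ∈ [a₁,b₁] the section f_{t₁} is strongly Henstock–Kurzweil integrable on [a₂,b₂] and for every t₂ ∈ [a₂,b₂] the section f_{t₂} is strongly Henstock–Kurzweil integrable on [a₁,b₁]. Then the function h(t₂) = (HK)∫_{[a₁,b₁]} f_{t₂}, t₂ ∈ [a₂,b₂], is strongly Henstock–Kurzweil integrable on [a₂,b₂] and (HK)∫_{[a₂,b₂]} ((HK)∫_{[a₁,b₁]} f_{t₂}) = (HK)∫_{[a,b]} f. -/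

import Mathlib

open Set MeasureTheory

variable {E : Type*} [MeasureSpace E] [PseudoMetricSpace E] [Preorder E]
variable {X : Type*} [NormedAddCommGroup X] [NormedSpace ℝ X]

/-- The closed interval of a tagged item `(t, p, q)` is `[p, q]` (the tag is `t`). -/
def itemBox (x : E × E × E) : Set E := Set.Icc x.2.1 x.2.2

/-- `[p,q]` is a closed non-degenerate subinterval of `K`. -/
def IsSubinterval (K : Set E) (p q : E) : Prop :=
  Set.Icc p q ⊆ K ∧ (interior (Set.Icc p q)).Nonempty

/-- `P` is an `𝓜`-partition of `K`: a finite collection of tagged pairwise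
non-overlapping closed non-degenerate subintervals of `K` covering `K`, with tags in `K`. -/
def IsMPartition (K : Set E) (P : Finset (E × E × E)) : Prop :=
  (∀ x ∈ P, x.1 ∈ K ∧ IsSubinterval K x.2.1 x.2.2) ∧
  (∀ x ∈ P, ∀ y ∈ P, x ≠ y → interior (itemBox x) ∩ interior (itemBox y) = ∅) ∧
  (⋃ x ∈ P, itemBox x) = K

/-- `𝓗𝓚`-partition: an `𝓜`-partition each of whose tags belongs to its interval. -/
def IsHKPartition (K : Set E) (P : Finset (E × E × E)) : Prop :=
  IsMPartition K P ∧ ∀ x ∈ P, x.1 ∈ itemBox x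

/-- A gauge on `K`: positive on `K`. -/
def IsGauge (K : Set E) (δ : E → ℝ) : Prop := ∀ t ∈ K, 0 < δ t

/-- A tagged partition is `δ`-fine if each interval lies in the open ball
around its tag of radius `δ(tag)`. -/
def IsFine (δ : E → ℝ) (P : Finset (E × E × E)) : Prop :=
  ∀ x ∈ P, itemBox x ⊆ Metric.ball x.1 (δ x.1)

/-- `f` is McShane integrable on `K` with integral `v`. -/
def HasMcShaneIntegral (K : Set E) (f : E → X) (v : X) : Prop :=
  ∀ ε > 0, ∃ δ : E → ℝ, IsGauge K δ ∧
    ∀ P : Finset (E × E × E), IsMPartition K P → IsFine δ P →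
      ‖(∑ x ∈ P, (volume (itemBox x)).toReal • f x.1) - v‖ < ε

/-- `f` is Henstock–Kurzweil integrable on `K` with integral `v`. -/
def HasHKIntegral (K : Set E) (f : E → X) (v : X) : Prop :=
  ∀ ε > 0, ∃ δ : E → ℝ, IsGauge K δ ∧
    ∀ P : Finset (E × E × E), IsHKPartition K P → IsFine δ P →
      ‖(∑ x ∈ P, (volume (itemBox x)).toReal • f x.1) - v‖ < ε

/-- An additive interval function on the non-degenerate closed subintervals of `K`
(an interval is recorded by its pair of corners). -/
def IsAdditiveIntervalFun (K : Set E) (F : E × E → X) : Prop :=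
  ∀ p q r s u w : E, IsSubinterval K p q → IsSubinterval K r s → IsSubinterval K u w →
    interior (Set.Icc p q) ∩ interior (Set.Icc r s) = ∅ →
    Set.Icc p q ∪ Set.Icc r s = Set.Icc u w →
    F (u, w) = F (p, q) + F (r, s)

/-- `f` is strongly McShane integrable on `[a,b]` with `(M)∫_{[a,b]} f = v`. -/
def HasStrongMcShaneIntegral (a b : E) (f : E → X) (v : X) : Prop :=
  ∃ F : E × E → X, IsAdditiveIntervalFun (Set.Icc a b) F ∧ F (a, b) = v ∧
    ∀ ε > 0, ∃ δ : E → ℝ, IsGauge (Set.Icc a b) δ ∧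
      ∀ P : Finset (E × E × E), IsMPartition (Set.Icc a b) P → IsFine δ P →
        ∑ x ∈ P, ‖(volume (itemBox x)).toReal • f x.1 - F (x.2.1, x.2.2)‖ < ε

/-- `f` is strongly Henstock–Kurzweil integrable on `[a,b]` with `(HK)∫_{[a,b]} f = v`. -/
def HasStrongHKIntegral (a b : E) (f : E → X) (v : X) : Prop :=
  ∃ F : E × E → X, IsAdditiveIntervalFun (Set.Icc a b) F ∧ F (a, b) = v ∧
    ∀ ε > 0, ∃ δ : E → ℝ, IsGauge (Set.Icc a b) δ ∧
      ∀ P : Finset (E × E × E), IsHKPartition (Set.Icc a b) P → IsFine δ P →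
        ∑ x ∈ P, ‖(volume (itemBox x)).toReal • f x.1 - F (x.2.1, x.2.2)‖ < ε

/-- Property `𝓢*𝓜` on `[a,b]`. -/
def PropSM (a b : E) (f : E → X) : Prop :=
  ∀ ε > 0, ∃ δ : E → ℝ, IsGauge (Set.Icc a b) δ ∧
    ∀ P Q : Finset (E × E × E),
      IsMPartition (Set.Icc a b) P → IsFine δ P →
      IsMPartition (Set.Icc a b) Q → IsFine δ Q →
      ∑ x ∈ P, ∑ y ∈ Q, ‖f x.1 - f y.1‖ * (volume (itemBox x ∩ itemBox y)).toReal < ε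

/-- Property `𝓢*𝓗𝓚` on `[a,b]`. -/
def PropSHK (a b : E) (f : E → X) : Prop :=
  ∀ ε > 0, ∃ δ : E → ℝ, IsGauge (Set.Icc a b) δ ∧
    ∀ P Q : Finset (E × E × E),
      IsHKPartition (Set.Icc a b) P → IsFine δ P →
      IsHKPartition (Set.Icc a b) Q → IsFine δ Q →
      ∑ x ∈ P, ∑ y ∈ Q, ‖f x.1 - f y.1‖ * (volume (itemBox x ∩ itemBox y)).toReal < ε


lemma isSubinterval_real_iff {a b p q : ℝ} :
    IsSubinterval (Icc a b) p q ↔ p < q ∧ a ≤ p ∧ q ≤ b := by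
  unfold IsSubinterval
  rw [interior_Icc, nonempty_Ioo]
  constructor
  · rintro ⟨h1, h2⟩
    exact ⟨h2, (Icc_subset_Icc_iff h2.le).1 h1⟩
  · rintro ⟨h1, h2⟩
    exact ⟨(Icc_subset_Icc_iff h1.le).2 h2, h1⟩

lemma IsSubinterval.prod {a₁ b₁ a₂ b₂ p₁ q₁ p₂ q₂ : ℝ} (h₁ : IsSubinterval (Icc a₁ b₁) p₁ q₁)
    (h₂ : IsSubinterval (Icc a₂ b₂) p₂ q₂) :
    IsSubinterval (Icc (a₁, a₂) (b₁, b₂)) (p₁, p₂) (q₁, q₂) := by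
  unfold IsSubinterval
  rw [← Icc_prod_Icc, ← Icc_prod_Icc, interior_prod_eq]
  exact ⟨prod_mono h₁.1 h₂.1, h₁.2.prod h₂.2⟩

/-- Freezing the second factor of an additive function of planar intervals. -/
lemma IsAdditiveIntervalFun.fst {X : Type*} [NormedAddCommGroup X] {a₁ b₁ a₂ b₂ : ℝ}
    {F : (ℝ × ℝ) × (ℝ × ℝ) → X} (hF : IsAdditiveIntervalFun (Icc (a₁, a₂) (b₁, b₂)) F)
    {p₂ q₂ : ℝ} (h₂ : IsSubinterval (Icc a₂ b₂) p₂ q₂) :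
    IsAdditiveIntervalFun (Icc a₁ b₁) fun I : ℝ × ℝ => F ((I.1, p₂), (I.2, q₂)) := by
  intro p q r s u w hpq hrs huw hd hu
  refine hF _ _ _ _ _ _ (hpq.prod h₂) (hrs.prod h₂) (huw.prod h₂) ?_ ?_
  · rw [← Icc_prod_Icc, ← Icc_prod_Icc, interior_prod_eq, interior_prod_eq, prod_inter_prod, hd,
      empty_prod]
  · rw [← Icc_prod_Icc, ← Icc_prod_Icc, ← Icc_prod_Icc, ← union_prod, hu]

/-- Freezing the first factor of an additive function of planar intervals. -/
lemma IsAdditiveIntervalFun.snd {X : Type*} [NormedAddCommGroup X] {a₁ b₁ a₂ b₂ : ℝ}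
    {F : (ℝ × ℝ) × (ℝ × ℝ) → X} (hF : IsAdditiveIntervalFun (Icc (a₁, a₂) (b₁, b₂)) F)
    {p₁ q₁ : ℝ} (h₁ : IsSubinterval (Icc a₁ b₁) p₁ q₁) :
    IsAdditiveIntervalFun (Icc a₂ b₂) fun J : ℝ × ℝ => F ((p₁, J.1), (q₁, J.2)) := by
  intro p q r s u w hpq hrs huw hd hu
  refine hF _ _ _ _ _ _ (h₁.prod hpq) (h₁.prod hrs) (h₁.prod huw) ?_ ?_
  · rw [← Icc_prod_Icc, ← Icc_prod_Icc, interior_prod_eq, interior_prod_eq, prod_inter_prod, hd,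
      prod_empty]
  · rw [← Icc_prod_Icc, ← Icc_prod_Icc, ← Icc_prod_Icc, ← prod_union, hu]

/-- `P` is a `δ`-fine HK-partition of `[c, d]` over which every interval function that is
additive on `[a, b]` sums up to its value on `[c, d]`. -/
def IsCousinPartition (X : Type*) [NormedAddCommGroup X] (a b : ℝ) (δ : ℝ → ℝ) (c d : ℝ)
    (P : Finset (ℝ × ℝ × ℝ)) : Prop :=
  IsHKPartition (Icc c d) P ∧ IsFine δ P ∧
    ∀ G : ℝ × ℝ → X, IsAdditiveIntervalFun (Icc a b) G → G (c, d) = ∑ x ∈ P, G (x.2.1, x.2.2)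

section Cousin

variable {X : Type*} [NormedAddCommGroup X] {a b c d e : ℝ} {δ : ℝ → ℝ}

lemma isCousinPartition_singleton {t : ℝ} (hcd : c < d) (ht : t ∈ Icc c d)
    (hδ : Icc c d ⊆ Metric.ball t (δ t)) :
    IsCousinPartition X a b δ c d {(t, c, d)} := by
  refine ⟨⟨⟨?_, ?_, ?_⟩, ?_⟩, ?_, ?_⟩
  · simp only [Finset.mem_singleton, forall_eq]
    exact ⟨ht, isSubinterval_real_iff.2 ⟨hcd, le_rfl, le_rfl⟩⟩
  · simp
  · simp [itemBox]
  · simpa [itemBox] using ht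
  · simpa [IsFine, itemBox] using hδ
  · simp

lemma IsCousinPartition.union {P Q : Finset (ℝ × ℝ × ℝ)} (hac : a ≤ c) (hcd : c < d) (hde : d < e)
    (heb : e ≤ b) (hP : IsCousinPartition X a b δ c d P) (hQ : IsCousinPartition X a b δ d e Q) :
    IsCousinPartition X a b δ c e (P ∪ Q) := by
  obtain ⟨⟨⟨hP1, hP2, hP3⟩, hP4⟩, hP5, hP6⟩ := hP
  obtain ⟨⟨⟨hQ1, hQ2, hQ3⟩, hQ4⟩, hQ5, hQ6⟩ := hQ
  have key : ∀ x ∈ P, ∀ y ∈ Q, interior (itemBox x) ∩ interior (itemBox y) = ∅ := by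
    intro x hx y hy
    have h1 := isSubinterval_real_iff.1 (hP1 x hx).2
    have h2 := isSubinterval_real_iff.1 (hQ1 y hy).2
    simp only [itemBox, interior_Icc]
    ext z
    simp only [mem_inter_iff, mem_Ioo, mem_empty_iff_false, iff_false]
    rintro ⟨⟨_, h3⟩, h4, _⟩
    linarith [h1.2.2, h2.2.1]
  have hdisj : Disjoint P Q := by
    rw [Finset.disjoint_left]
    intro x hx hy
    have h1 := isSubinterval_real_iff.1 (hP1 x hx).2
    have h2 := isSubinterval_real_iff.1 (hQ1 x hy).2
    linarith [h1.2.2, h2.2.1]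
  have hce : Icc c d ∪ Icc d e = Icc c e := Icc_union_Icc_eq_Icc hcd.le hde.le
  refine ⟨⟨⟨?_, ?_, ?_⟩, ?_⟩, ?_, ?_⟩
  · intro x hx
    rcases Finset.mem_union.1 hx with hx | hx
    · refine ⟨hce ▸ Or.inl (hP1 x hx).1, ?_, (hP1 x hx).2.2⟩
      exact (hP1 x hx).2.1.trans (Icc_subset_Icc le_rfl hde.le)
    · refine ⟨hce ▸ Or.inr (hQ1 x hx).1, ?_, (hQ1 x hx).2.2⟩
      exact (hQ1 x hx).2.1.trans (Icc_subset_Icc hcd.le le_rfl)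
  · intro x hx y hy hxy
    rcases Finset.mem_union.1 hx with hx | hx <;> rcases Finset.mem_union.1 hy with hy | hy
    · exact hP2 x hx y hy hxy
    · exact key x hx y hy
    · rw [inter_comm]
      exact key y hy x hx
    · exact hQ2 x hx y hy hxy
  · rw [Finset.set_biUnion_union, hP3, hQ3, hce]
  · intro x hx
    exact (Finset.mem_union.1 hx).elim (hP4 x) (hQ4 x)
  · intro x hx
    exact (Finset.mem_union.1 hx).elim (hP5 x) (hQ5 x)
  · intro G hG
    rw [Finset.sum_union hdisj, ← hP6 G hG, ← hQ6 G hG]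
    refine hG _ _ _ _ _ _ ?_ ?_ ?_ ?_ hce
    · exact isSubinterval_real_iff.2 ⟨hcd, hac, by linarith⟩
    · exact isSubinterval_real_iff.2 ⟨hde, by linarith, heb⟩
    · exact isSubinterval_real_iff.2 ⟨hcd.trans hde, hac, heb⟩
    · simp only [interior_Icc]
      ext z
      simp only [mem_inter_iff, mem_Ioo, mem_empty_iff_false, iff_false]
      rintro ⟨⟨_, h3⟩, h4, _⟩
      linarith

/-- Cousin's lemma. -/
lemma exists_isCousinPartition (X : Type*) [NormedAddCommGroup X] (hab : a < b)
    (hδ : IsGauge (Icc a b) δ) : ∃ P, IsCousinPartition X a b δ a b P := by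
  set S : Set ℝ := {x | x ∈ Icc a b ∧ (x = a ∨ ∃ P, IsCousinPartition X a b δ a x P)} with hS
  have haS : a ∈ S := ⟨⟨le_rfl, hab.le⟩, Or.inl rfl⟩
  have hbdd : BddAbove S := ⟨b, fun x hx => hx.1.2⟩
  have hac : a ≤ sSup S := le_csSup hbdd haS
  have hcb : sSup S ≤ b := csSup_le ⟨a, haS⟩ fun x hx => hx.1.2
  set c := sSup S with hc
  have hδc : 0 < δ c := hδ c ⟨hac, hcb⟩
  obtain ⟨x, hxS, hx⟩ := exists_lt_of_lt_csSup ⟨a, haS⟩ (show c - δ c < sSup S by linarith)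
  have hxc : x ≤ c := le_csSup hbdd hxS
  set y := min b (c + δ c / 2) with hy
  have hcy : c ≤ y := le_min hcb (by linarith)
  have hyb : y ≤ b := min_le_left _ _
  have hyc : y ≤ c + δ c / 2 := min_le_right _ _
  have hyS : y ∈ S := by
    rcases (hxc.trans hcy).eq_or_lt with hxy | hxy
    · rwa [← hxy]
    have hone : IsCousinPartition X a b δ x y {(c, x, y)} := by
      refine isCousinPartition_singleton hxy ⟨hxc, hcy⟩ ?_
      intro z hz
      rw [Metric.mem_ball, Real.dist_eq, abs_lt]
      constructor <;> linarith [hz.1, hz.2]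
    refine ⟨⟨hac.trans hcy, hyb⟩, Or.inr ?_⟩
    by_cases hxa : x = a
    · subst hxa
      exact ⟨_, hone⟩
    · obtain ⟨P, hP⟩ := hxS.2.resolve_left hxa
      exact ⟨_, hP.union le_rfl (lt_of_le_of_ne hxS.1.1 (Ne.symm hxa)) hxy hyb hone⟩
  have hyc' : y ≤ c := le_csSup hbdd hyS
  have hby : y = b := by
    rcases min_choice b (c + δ c / 2) with h | h
    · exact h
    · rw [← hy] at h
      linarith
  rw [hby] at hyS
  exact hyS.2.resolve_left hab.ne'

end Cousin

lemma exists_pos_le_of_finset {ι : Type*} (s : Finset ι) (g : ι → ℝ) (hg : ∀ i ∈ s, 0 < g i) :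
    ∃ r > 0, ∀ i ∈ s, r ≤ g i := by
  classical
  induction s using Finset.induction_on with
  | empty => exact ⟨1, one_pos, by simp⟩
  | insert i s _ ih =>
    obtain ⟨r, hr, h⟩ := ih fun j hj => hg j (Finset.mem_insert_of_mem hj)
    refine ⟨min r (g i), lt_min hr (hg i (Finset.mem_insert_self _ _)), fun j hj => ?_⟩
    rcases Finset.mem_insert.1 hj with rfl | hj
    · exact min_le_right _ _
    · exact (min_le_left _ _).trans (h j hj)

lemma IsMPartition.sum_volume_le {a b : ℝ} (hab : a ≤ b) {P : Finset (ℝ × ℝ × ℝ)}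
    (hP : IsMPartition (Icc a b) P) : ∑ x ∈ P, (volume (itemBox x)).toReal ≤ b - a := by
  have hvol : ∀ x : ℝ × ℝ × ℝ, volume (itemBox x) = volume (interior (itemBox x)) := by
    intro x
    simp [itemBox]
  have hsum : ∑ x ∈ P, volume (itemBox x) ≤ volume (Icc a b) := by
    simp_rw [hvol]
    rw [← measure_biUnion_finset]
    · refine measure_mono (iUnion₂_subset fun x hx => interior_subset.trans (hP.1 x hx).2.1)
    · intro x hx y hy hxy
      exact disjoint_iff_inter_eq_empty.2 (hP.2.1 x hx y hy hxy)
    · exact fun x _ => isOpen_interior.measurableSet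
  rw [← ENNReal.toReal_sum fun x _ => by simp [itemBox]]
  have := ENNReal.toReal_mono (by simp) hsum
  rwa [Real.volume_Icc, ENNReal.toReal_ofReal (sub_nonneg.2 hab)] at this

/-- The tagged box with sides the intervals of `x` and `y`, tagged by the pair of the tags. -/
def prodItem (x y : ℝ × ℝ × ℝ) : (ℝ × ℝ) × (ℝ × ℝ) × (ℝ × ℝ) :=
  ((x.1, y.1), (x.2.1, y.2.1), (x.2.2, y.2.2))

lemma itemBox_prodItem (x y : ℝ × ℝ × ℝ) :
    itemBox (prodItem x y) = itemBox x ×ˢ itemBox y :=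
  (Icc_prod_Icc _ _ _ _).symm

lemma prodItem_inj {x y x' y' : ℝ × ℝ × ℝ} :
    prodItem x y = prodItem x' y' ↔ x = x' ∧ y = y' := by
  simp only [prodItem, Prod.ext_iff]
  tauto

lemma volume_prodItem (x y : ℝ × ℝ × ℝ) :
    (volume (itemBox (prodItem x y))).toReal =
      (volume (itemBox y)).toReal * (volume (itemBox x)).toReal := by
  rw [itemBox_prodItem, Measure.volume_eq_prod, Measure.prod_prod, ENNReal.toReal_mul, mul_comm]

/-- The planar partition whose rows over the intervals of `P` are subdivided by `Q`. -/
noncomputable def rowPartition (P : Finset (ℝ × ℝ × ℝ)) (Q : ℝ → Finset (ℝ × ℝ × ℝ)) :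
    Finset ((ℝ × ℝ) × (ℝ × ℝ) × (ℝ × ℝ)) :=
  (P.sigma fun y => Q y.1).image fun z => prodItem z.2 z.1

section Row

variable {P : Finset (ℝ × ℝ × ℝ)} {Q : ℝ → Finset (ℝ × ℝ × ℝ)}

lemma forall_mem_rowPartition {p : (ℝ × ℝ) × (ℝ × ℝ) × (ℝ × ℝ) → Prop} :
    (∀ z ∈ rowPartition P Q, p z) ↔ ∀ y ∈ P, ∀ x ∈ Q y.1, p (prodItem x y) := by
  simp only [rowPartition, Finset.forall_mem_image, Finset.mem_sigma]
  exact ⟨fun h y hy x hx => h (x := ⟨y, x⟩) ⟨hy, hx⟩, fun h z hz => h z.1 hz.1 z.2 hz.2⟩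

lemma sum_rowPartition {M : Type*} [AddCommMonoid M] (g : (ℝ × ℝ) × (ℝ × ℝ) × (ℝ × ℝ) → M) :
    ∑ z ∈ rowPartition P Q, g z = ∑ y ∈ P, ∑ x ∈ Q y.1, g (prodItem x y) := by
  rw [rowPartition, Finset.sum_image, Finset.sum_sigma]
  rintro ⟨y, x⟩ _ ⟨y', x'⟩ _ h
  obtain ⟨rfl, rfl⟩ := prodItem_inj.1 h
  rfl

lemma isHKPartition_rowPartition {a₁ b₁ a₂ b₂ : ℝ} (hP : IsHKPartition (Icc a₂ b₂) P)
    (hQ : ∀ t ∈ Icc a₂ b₂, IsHKPartition (Icc a₁ b₁) (Q t)) :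
    IsHKPartition (Icc (a₁, a₂) (b₁, b₂)) (rowPartition P Q) := by
  have hQ' : ∀ y ∈ P, IsHKPartition (Icc a₁ b₁) (Q y.1) := fun y hy => hQ _ (hP.1.1 y hy).1
  refine ⟨⟨?_, ?_, ?_⟩, ?_⟩
  · refine forall_mem_rowPartition.2 fun y hy x hx => ⟨?_, ?_⟩
    · rw [← Icc_prod_Icc]
      exact ⟨((hQ' y hy).1.1 x hx).1, (hP.1.1 y hy).1⟩
    · exact ((hQ' y hy).1.1 x hx).2.prod (hP.1.1 y hy).2
  · refine forall_mem_rowPartition.2 fun y hy x hx => ?_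
    refine forall_mem_rowPartition.2 fun y' hy' x' hx' hne => ?_
    rw [itemBox_prodItem, itemBox_prodItem, interior_prod_eq, interior_prod_eq, prod_inter_prod]
    by_cases hyy : y = y'
    · subst hyy
      have hxx : x ≠ x' := by
        rintro rfl
        exact hne rfl
      rw [(hQ' y hy).1.2.1 x hx x' hx' hxx, empty_prod]
    · rw [hP.1.2.1 y hy y' hy' hyy, prod_empty]
  · rw [← Icc_prod_Icc]
    refine Subset.antisymm ?_ ?_
    · refine iUnion₂_subset (forall_mem_rowPartition.2 fun y hy x hx => ?_)
      rw [itemBox_prodItem]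
      exact prod_mono ((hQ' y hy).1.1 x hx).2.1 (hP.1.1 y hy).2.1
    · rintro ⟨u, w⟩ ⟨hu, hw⟩
      rw [← hP.1.2.2] at hw
      obtain ⟨y, hy, hwy⟩ := mem_iUnion₂.1 hw
      rw [← (hQ' y hy).1.2.2] at hu
      obtain ⟨x, hx, hux⟩ := mem_iUnion₂.1 hu
      refine mem_iUnion₂.2 ⟨prodItem x y, ?_, ?_⟩
      · exact forall_mem_rowPartition.1 (fun z hz => hz) y hy x hx
      · rw [itemBox_prodItem]
        exact ⟨hux, hwy⟩
  · refine forall_mem_rowPartition.2 fun y hy x hx => ?_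
    rw [itemBox_prodItem]
    exact ⟨(hQ' y hy).2 x hx, hP.2 y hy⟩

end Row

/-- Lemma 2.2(ii) for the Henstock–Kurzweil integral:
if `f` is strongly integrable on `[a,b]` with integral `v` and all sections are strongly
integrable, then the iterated integral of the sections is strongly integrable with integral `v`. -/
theorem fubini_strong_hk_snd {X : Type*} [NormedAddCommGroup X] [NormedSpace ℝ X] [CompleteSpace X] (a₁ b₁ a₂ b₂ : ℝ) (hab₁ : a₁ < b₁) (hab₂ : a₂ < b₂)
    (f : ℝ × ℝ → X) (v : X) (h : ℝ → X)
    (hf : HasStrongHKIntegral ((a₁, a₂) : ℝ × ℝ) (b₁, b₂) f v)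
    (hh : ∀ t₂ ∈ Set.Icc a₂ b₂, HasStrongHKIntegral a₁ b₁ (fun s₁ => f (s₁, t₂)) (h t₂))
    (hsec : ∀ t₁ ∈ Set.Icc a₁ b₁, ∃ u : X, HasStrongHKIntegral a₂ b₂ (fun s₂ => f (t₁, s₂)) u) :
    HasStrongHKIntegral a₂ b₂ h v := by
  obtain ⟨F, hF, hFv, hFε⟩ := hf
  have hI₁ : IsSubinterval (Icc a₁ b₁) a₁ b₁ := isSubinterval_real_iff.2 ⟨hab₁, le_rfl, le_rfl⟩
  refine ⟨fun J => F ((a₁, J.1), (b₁, J.2)), hF.snd hI₁, hFv, fun ε hε => ?_⟩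
  obtain ⟨δ, hδ, hδF⟩ := hFε (ε / 2) (half_pos hε)
  have hpos : 0 < b₂ - a₂ := sub_pos.2 hab₂
  set c := ε / 2 / (b₂ - a₂) with hc
  have hc0 : 0 < c := div_pos (half_pos hε) hpos
  have hrow : ∀ t, ∃ (Q : Finset (ℝ × ℝ × ℝ)) (r : ℝ), t ∈ Icc a₂ b₂ →
      IsCousinPartition X a₁ b₁ (fun s => δ (s, t)) a₁ b₁ Q ∧
      ‖∑ x ∈ Q, (volume (itemBox x)).toReal • f (x.1, t) - h t‖ ≤ c ∧
      0 < r ∧ ∀ x ∈ Q, r ≤ δ (x.1, t) := by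
    intro t
    by_cases ht : t ∈ Icc a₂ b₂
    swap
    · exact ⟨∅, 0, fun h => absurd h ht⟩
    obtain ⟨G, hG, hGv, hGε⟩ := hh t ht
    obtain ⟨η, hη, hηG⟩ := hGε c hc0
    have hδt : ∀ s ∈ Icc a₁ b₁, 0 < δ (s, t) := by
      intro s hs
      refine hδ _ ?_
      rw [← Icc_prod_Icc]
      exact ⟨hs, ht⟩
    obtain ⟨Q, hQ, hQfine, hQsum⟩ := exists_isCousinPartition X (δ := fun s => min (η s) (δ (s, t)))
      hab₁ fun s hs => lt_min (hη s hs) (hδt s hs)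
    obtain ⟨r, hr, hrQ⟩ := exists_pos_le_of_finset Q (fun x => δ (x.1, t))
      fun x hx => hδt _ (hQ.1.1 x hx).1
    refine ⟨Q, r, fun _ => ⟨⟨hQ, ?_, hQsum⟩, ?_, hr, hrQ⟩⟩
    · exact fun x hx => (hQfine x hx).trans (Metric.ball_subset_ball (min_le_right _ _))
    · rw [← hGv, hQsum G hG, ← Finset.sum_sub_distrib]
      refine (norm_sum_le _ _).trans (hηG Q hQ ?_).le
      exact fun x hx => (hQfine x hx).trans (Metric.ball_subset_ball (min_le_left _ _))
  choose Q r hQr using hrow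
  refine ⟨r, fun t ht => (hQr t ht).2.2.1, fun P hP hPfine => ?_⟩
  have htag : ∀ y ∈ P, y.1 ∈ Icc a₂ b₂ := fun y hy => (hP.1.1 y hy).1
  have hfine : IsFine δ (rowPartition P Q) := by
    refine forall_mem_rowPartition.2 fun y hy x hx => ?_
    obtain ⟨⟨_, hQfine, _⟩, _, _, hr⟩ := hQr _ (htag y hy)
    rw [itemBox_prodItem]
    refine (prod_mono (hQfine x hx) ((hPfine y hy).trans
      (Metric.ball_subset_ball (hr x hx)))).trans ?_
    rw [ball_prod_same]
    rfl
  have hplane := hδF _ (isHKPartition_rowPartition hP fun t ht => (hQr t ht).1.1) hfine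
  rw [sum_rowPartition] at hplane
  have hterm : ∀ y ∈ P,
      ‖(volume (itemBox y)).toReal • h y.1 - F ((a₁, y.2.1), (b₁, y.2.2))‖ ≤
        (volume (itemBox y)).toReal * c +
          ∑ x ∈ Q y.1, ‖(volume (itemBox (prodItem x y))).toReal • f (prodItem x y).1 -
            F ((prodItem x y).2.1, (prodItem x y).2.2)‖ := by
    intro y hy
    obtain ⟨⟨_, _, hsum⟩, hsec_le, _⟩ := hQr _ (htag y hy)
    have hadd := hsum _ (hF.fst (hP.1.1 y hy).2)
    simp only at hadd
    have hsplit : (volume (itemBox y)).toReal • h y.1 - F ((a₁, y.2.1), (b₁, y.2.2)) =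
        (volume (itemBox y)).toReal •
          (h y.1 - ∑ x ∈ Q y.1, (volume (itemBox x)).toReal • f (x.1, y.1)) +
        ∑ x ∈ Q y.1, ((volume (itemBox (prodItem x y))).toReal • f (prodItem x y).1 -
            F ((prodItem x y).2.1, (prodItem x y).2.2)) := by
      simp only [volume_prodItem, mul_smul, Finset.sum_sub_distrib, ← Finset.smul_sum]
      rw [hadd, smul_sub]
      simp only [prodItem]
      abel
    rw [hsplit]
    refine (norm_add_le _ _).trans (add_le_add ?_ (norm_sum_le _ _))
    rw [norm_smul, Real.norm_of_nonneg ENNReal.toReal_nonneg, norm_sub_rev]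
    exact mul_le_mul_of_nonneg_left hsec_le ENNReal.toReal_nonneg
  have hvol : (∑ y ∈ P, (volume (itemBox y)).toReal) * c ≤ ε / 2 := by
    refine (mul_le_mul_of_nonneg_right (hP.1.sum_volume_le hab₂.le) hc0.le).trans_eq ?_
    rw [hc, mul_div_cancel₀ _ hpos.ne']
  refine (Finset.sum_le_sum hterm).trans_lt ?_
  rw [Finset.sum_add_distrib, ← Finset.sum_mul]
  linarith
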